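/- Let $m > 2$ be an integer and $J(f) = \|\nabla f\|_{L^2(\Omega)}^{2(m+1)} / \|f\|_{L^{2(m+1)}(\Omega)}^{2(m+1)}$ for radial $f \in \dot H^1_0(\Omega)\setminus\{0\}$, $\Omega = \{|x|>1\}$. Then the infimum $a = \inf J(f)$ over nonzero radial $f \in \dot H^1_0(\Omega)$ is attained, i.e. there exists a radial $\varphi_* \in \dot H^1_0(\Omega)$ with $\|\nabla\varphi_*\|_{L^2} = 1$ and $J(\varphi_*) = a$, and $0 < a < \infty$. -/

import Mathlib

open MeasureTheory Real Set Filter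

/-- Admissible radial functions: radial profiles of functions in
`Ḣ¹₀(Ω) \ {0}`, `Ω = {|x| > 1} ⊂ ℝ³`, with finite `L^{2(m+1)}` norm. -/
def AdmissibleRadial (m : ℕ) (f : ℝ → ℝ) : Prop :=
  ContinuousOn f (Ici 1) ∧ f 1 = 0 ∧ DifferentiableOn ℝ f (Ioi 1) ∧
  Tendsto f atTop (nhds 0) ∧
  IntegrableOn (fun r => (deriv f r)^2 * r^2) (Ioi 1) ∧
  IntegrableOn (fun r => |f r| ^ (2 * (m + 1)) * r^2) (Ioi 1) ∧
  (∃ r : ℝ, 1 < r ∧ f r ≠ 0)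

/-- The Sobolev quotient `J(f) = ‖∇f‖_{L²(Ω)}^{2(m+1)} / ‖f‖_{L^{2(m+1)}(Ω)}^{2(m+1)}`
in radial coordinates. -/
noncomputable def SobolevQuotient (m : ℕ) (f : ℝ → ℝ) : ℝ :=
  (4 * π * ∫ r in Ioi 1, (deriv f r)^2 * r^2) ^ (m + 1)
    / (4 * π * ∫ r in Ioi 1, |f r| ^ (2 * (m + 1)) * r^2)

open scoped Topology

theorem exists_subseq_tendsto_inner {H : Type*} [NormedAddCommGroup H] [InnerProductSpace ℝ H]
    [CompleteSpace H] [TopologicalSpace.SeparableSpace H] {u : ℕ → H} {C : ℝ}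
    (hu : ∀ n, ‖u n‖ ≤ C) :
    ∃ g : H, ‖g‖ ≤ C ∧ ∃ σ : ℕ → ℕ, StrictMono σ ∧
      ∀ x, Tendsto (fun n => inner ℝ (u (σ n)) x) atTop (𝓝 (inner ℝ g x)) := by
  have hball : ∀ n, StrongDual.toWeakDual (InnerProductSpace.toDual ℝ H (u n)) ∈
      WeakDual.toStrongDual ⁻¹' Metric.closedBall (0 : StrongDual ℝ H) C := by
    intro n
    have : ‖InnerProductSpace.toDual ℝ H (u n)‖ ≤ C := by simpa using hu n
    simpa using this
  obtain ⟨φ, hφ, σ, hσ, hlim⟩ := WeakDual.isSeqCompact_closedBall ℝ H 0 C hball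
  refine ⟨(InnerProductSpace.toDual ℝ H).symm (WeakDual.toStrongDual φ), ?_, σ, hσ, fun x => ?_⟩
  · simpa using hφ
  · rw [InnerProductSpace.toDual_symm_apply]
    have := ((WeakDual.eval_continuous x).tendsto φ).comp hlim
    simpa [Function.comp_def] using this

theorem add_mul_sub_le_pow_of_even (n : ℕ) (x y : ℝ) :
    y ^ (2 * (n + 1)) + (2 * (n + 1)) * y ^ (2 * n + 1) * (x - y) ≤ x ^ (2 * (n + 1)) := by
  have hx : 0 ≤ x ^ (2 * (n + 1)) := (even_two_mul _).pow_nonneg x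
  rcases eq_or_ne y 0 with rfl | hy
  · simpa using hx
  have hy' : 0 < y ^ (2 * (n + 1)) := (even_two_mul _).pow_pos hy
  have key : 1 + (2 * (n + 1)) * (x / y - 1) ≤ (x / y) ^ (2 * (n + 1)) := by
    rcases le_total (-2) (x / y - 1) with h | h
    · have := one_add_mul_le_pow h (2 * (n + 1))
      rw [add_sub_cancel] at this
      exact_mod_cast this
    · have h0 : 0 ≤ (x / y) ^ (2 * (n + 1)) := (even_two_mul _).pow_nonneg _
      have : (0 : ℝ) ≤ n := n.cast_nonneg
      nlinarith
  have := mul_le_mul_of_nonneg_left key hy'.le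
  rw [div_pow, mul_div_cancel₀ _ hy'.ne'] at this
  refine le_trans (le_of_eq ?_) this
  field_simp
  ring

theorem integrableOn_rpow_neg_three_halves (C : ℝ) :
    IntegrableOn (fun r : ℝ => C * r ^ (-(3 / 2) : ℝ)) (Ioi 1) :=
  (integrableOn_Ioi_rpow_of_lt (by norm_num) one_pos).const_mul C

section Kernel

variable {H : Type*} [NormedAddCommGroup H] [InnerProductSpace ℝ H] {e : ℝ → H}

/-- The Gram relation `⟪e r, e s⟫ = 1 / max r s`: then `r ↦ ⟪g, e r⟫` is the profile of a radial
function on `{|x| > 1} ⊂ ℝ³` whose Dirichlet norm is controlled by `‖g‖`. -/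
def IsRadialKernel (e : ℝ → H) : Prop :=
  ∀ r s, 1 ≤ r → 1 ≤ s → inner ℝ (e r) (e s) = (max r s)⁻¹

/-- The weighted integral of the power `2 (m + 1)` of the profile `r ↦ ⟪g, e r⟫`. -/
noncomputable def kernelPower (e : ℝ → H) (m : ℕ) (g : H) : ℝ :=
  ∫ r in Ioi 1, inner ℝ g (e r) ^ (2 * (m + 1)) * r ^ 2

theorem norm_sq_kernel (he : IsRadialKernel e) {r : ℝ} (hr : 1 ≤ r) : ‖e r‖ ^ 2 = r⁻¹ := by
  rw [← real_inner_self_eq_norm_sq, he r r hr hr, max_self]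

theorem abs_inner_kernel_le (he : IsRadialKernel e) (g : H) {r : ℝ} (hr : 1 ≤ r) :
    |inner ℝ g (e r)| ≤ ‖g‖ * r ^ (-(1 / 2) : ℝ) := by
  refine (abs_real_inner_le_norm g (e r)).trans (mul_le_mul_of_nonneg_left ?_ (norm_nonneg g))
  refine le_of_eq ((sq_eq_sq₀ (norm_nonneg _) (by positivity)).1 ?_)
  rw [norm_sq_kernel he hr, ← rpow_natCast, ← rpow_mul (by linarith)]
  norm_num
  rw [rpow_neg_one]

theorem continuousOn_kernel (he : IsRadialKernel e) : ContinuousOn e (Ici 1) := by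
  intro r hr
  rw [ContinuousWithinAt, tendsto_iff_norm_sub_tendsto_zero]
  have hr' : (1 : ℝ) ≤ r := hr
  have h : ∀ s ∈ Ici (1 : ℝ), ‖e s - e r‖ = √ (s⁻¹ - 2 * (max s r)⁻¹ + r⁻¹) := by
    intro s hs
    rw [← Real.sqrt_sq (norm_nonneg (e s - e r)), norm_sub_sq_real, norm_sq_kernel he hs,
      norm_sq_kernel he hr, he s r hs hr]
  have hc : ContinuousWithinAt (fun s : ℝ => √ (s⁻¹ - 2 * (max s r)⁻¹ + r⁻¹)) (Ici 1) r := by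
    have : r ≠ 0 := by positivity
    have h2 : max r r ≠ 0 := by simpa
    refine ContinuousAt.continuousWithinAt ?_
    fun_prop (disch := assumption)
  have := hc.tendsto
  have h0 : √ (r⁻¹ - 2 * (max r r)⁻¹ + r⁻¹) = 0 := by
    rw [max_self]; ring_nf; simp
  rw [h0] at this
  exact this.congr' (by filter_upwards [self_mem_nhdsWithin] with s hs using (h s hs).symm)

theorem continuousOn_inner_kernel (he : IsRadialKernel e) (g : H) : ContinuousOn (fun r => inner ℝ g (e r)) (Ici 1) :=
  continuousOn_const.inner (continuousOn_kernel he)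

theorem inner_kernel_pow_le (he : IsRadialKernel e) {m : ℕ} (hm : 2 < m) (g : H) {r : ℝ} (hr : 1 ≤ r) :
    ‖inner ℝ g (e r) ^ (2 * m + 1) * r ^ 2‖ ≤ ‖g‖ ^ (2 * m + 1) * r ^ (-(3 / 2) : ℝ) := by
  have hr0 : 0 < r := by linarith
  rw [norm_mul, norm_pow, norm_pow, norm_eq_abs, norm_eq_abs, abs_of_pos hr0]
  calc |inner ℝ g (e r)| ^ (2 * m + 1) * r ^ 2
      ≤ (‖g‖ * r ^ (-(1 / 2) : ℝ)) ^ (2 * m + 1) * r ^ 2 := by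
        gcongr; exact abs_inner_kernel_le he g hr
    _ = ‖g‖ ^ (2 * m + 1) * r ^ (-(1 / 2) * ((2 * m + 1 : ℕ) : ℝ) + (2 : ℕ)) := by
        rw [mul_pow, rpow_add hr0, rpow_mul hr0.le, rpow_natCast, rpow_natCast]; ring
    _ ≤ _ := by
        gcongr
        have : (3 : ℝ) ≤ m := by exact_mod_cast hm
        push_cast
        linarith

theorem inner_kernel_pow_even_le (he : IsRadialKernel e) {m : ℕ} (hm : 2 < m) (g : H) {r : ℝ} (hr : 1 ≤ r) :
    ‖inner ℝ g (e r) ^ (2 * (m + 1)) * r ^ 2‖ ≤ ‖g‖ ^ (2 * (m + 1)) * r ^ (-(3 / 2) : ℝ) := by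
  have h1 : |inner ℝ g (e r)| ≤ ‖g‖ := by
    refine (abs_inner_kernel_le he g hr).trans (mul_le_of_le_one_right (norm_nonneg g) ?_)
    exact rpow_le_one_of_one_le_of_nonpos hr (by norm_num)
  calc ‖inner ℝ g (e r) ^ (2 * (m + 1)) * r ^ 2‖
      = |inner ℝ g (e r)| * ‖inner ℝ g (e r) ^ (2 * m + 1) * r ^ 2‖ := by
        rw [← norm_eq_abs, ← norm_mul]; congr 1; ring
    _ ≤ ‖g‖ * (‖g‖ ^ (2 * m + 1) * r ^ (-(3 / 2) : ℝ)) := by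
        gcongr; exact inner_kernel_pow_le he hm g hr
    _ = _ := by ring

theorem integrableOn_inner_kernel_pow (he : IsRadialKernel e) {m : ℕ} (hm : 2 < m) (g : H) :
    IntegrableOn (fun r => inner ℝ g (e r) ^ (2 * m + 1) * r ^ 2) (Ioi 1) := by
  refine (integrableOn_rpow_neg_three_halves (‖g‖ ^ (2 * m + 1))).mono' ?_ ?_
  · refine ContinuousOn.aestronglyMeasurable ?_ measurableSet_Ioi
    exact (((continuousOn_inner_kernel he g).mono Ioi_subset_Ici_self).pow _).mul
      (continuousOn_id.pow 2)
  · exact ae_restrict_of_forall_mem measurableSet_Ioi fun r hr =>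
      inner_kernel_pow_le he hm g (le_of_lt hr)

theorem integrableOn_inner_kernel_pow_even (he : IsRadialKernel e) {m : ℕ} (hm : 2 < m) (g : H) :
    IntegrableOn (fun r => inner ℝ g (e r) ^ (2 * (m + 1)) * r ^ 2) (Ioi 1) := by
  refine (integrableOn_rpow_neg_three_halves (‖g‖ ^ (2 * (m + 1)))).mono' ?_ ?_
  · refine ContinuousOn.aestronglyMeasurable ?_ measurableSet_Ioi
    exact (((continuousOn_inner_kernel he g).mono Ioi_subset_Ici_self).pow _).mul
      (continuousOn_id.pow 2)
  · exact ae_restrict_of_forall_mem measurableSet_Ioi fun r hr =>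
      inner_kernel_pow_even_le he hm g (le_of_lt hr)

theorem integrableOn_inner_kernel_pow_smul (he : IsRadialKernel e) {m : ℕ} (hm : 2 < m) (g : H) :
    IntegrableOn (fun r => (inner ℝ g (e r) ^ (2 * m + 1) * r ^ 2) • e r) (Ioi 1) := by
  refine (integrableOn_inner_kernel_pow he hm g).norm.mono' ?_ ?_
  · refine ContinuousOn.aestronglyMeasurable ?_ measurableSet_Ioi
    exact ((((continuousOn_inner_kernel he g).pow _).mul (continuousOn_id.pow 2)).smul
      (continuousOn_kernel he)).mono Ioi_subset_Ici_self
  · refine ae_restrict_of_forall_mem measurableSet_Ioi fun r hr => ?_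
    rw [norm_smul]
    refine mul_le_of_le_one_right (norm_nonneg _) ?_
    refine (sq_le_one_iff₀ (norm_nonneg _)).1 ?_
    rw [norm_sq_kernel he (le_of_lt hr)]
    exact inv_le_one_of_one_le₀ (le_of_lt hr)

theorem tendsto_kernelPower (he : IsRadialKernel e) {m : ℕ} (hm : 2 < m) {u : ℕ → H} {g : H}
    (hu : ∀ n, ‖u n‖ ≤ 1)
    (hlim : ∀ x, Tendsto (fun n => inner ℝ (u n) x) atTop (𝓝 (inner ℝ g x))) :
    Tendsto (fun n => kernelPower e m (u n)) atTop (𝓝 (kernelPower e m g)) := by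
  refine tendsto_integral_of_dominated_convergence _
    (fun n => (integrableOn_inner_kernel_pow_even he hm (u n)).aestronglyMeasurable)
    (integrableOn_rpow_neg_three_halves 1) (fun n => ?_) ?_
  · refine ae_restrict_of_forall_mem measurableSet_Ioi fun r hr => ?_
    have hr0 : (0 : ℝ) < r := one_pos.trans hr
    refine (inner_kernel_pow_even_le he hm (u n) (le_of_lt hr)).trans ?_
    gcongr
    exact pow_le_one₀ (norm_nonneg _) (hu n)
  · exact ae_restrict_of_forall_mem measurableSet_Ioi fun r _ =>
      ((hlim (e r)).pow _).mul_const _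

theorem exists_kernelPower_maximizer [CompleteSpace H] [TopologicalSpace.SeparableSpace H]
    (he : IsRadialKernel e) {m : ℕ} (hm : 2 < m) :
    ∃ g : H, ‖g‖ ≤ 1 ∧ inner ℝ g (e 1) = 0 ∧
      ∀ h : H, ‖h‖ ≤ 1 → inner ℝ h (e 1) = 0 → kernelPower e m h ≤ kernelPower e m g := by
  set B : Set H := {h | ‖h‖ ≤ 1 ∧ inner ℝ h (e 1) = 0}
  have hne : (kernelPower e m '' B).Nonempty := ⟨_, 0, by simp [B], rfl⟩
  have hbdd : BddAbove (kernelPower e m '' B) := by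
    refine ⟨∫ r in Ioi 1, 1 * r ^ (-(3 / 2) : ℝ), ?_⟩
    rintro _ ⟨h, hh, rfl⟩
    refine setIntegral_mono_on (integrableOn_inner_kernel_pow_even he hm h)
      (integrableOn_rpow_neg_three_halves 1) measurableSet_Ioi fun r hr => ?_
    have hr0 : (0 : ℝ) < r := one_pos.trans hr
    refine (le_norm_self _).trans ((inner_kernel_pow_even_le he hm h (le_of_lt hr)).trans ?_)
    gcongr
    exact pow_le_one₀ (norm_nonneg _) hh.1
  obtain ⟨v, -, hv, hvB⟩ := exists_seq_tendsto_sSup hne hbdd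
  choose u huB huv using hvB
  obtain ⟨g, hg, σ, hσ, hlim⟩ := exists_subseq_tendsto_inner (H := H) (u := u) fun n => (huB n).1
  have hval : Tendsto (fun n => kernelPower e m (u (σ n))) atTop
      (𝓝 (sSup (kernelPower e m '' B))) := by
    simp only [huv]
    exact hv.comp hσ.tendsto_atTop
  have hgmax := tendsto_nhds_unique hval
    (tendsto_kernelPower he hm (fun n => (huB (σ n)).1) hlim)
  refine ⟨g, hg, ?_, fun h h1 h2 => hgmax ▸ le_csSup hbdd ⟨h, ⟨h1, h2⟩, rfl⟩⟩
  refine tendsto_nhds_unique (hlim (e 1)) ?_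
  simp only [(huB _).2]
  exact tendsto_const_nhds

theorem kernelPower_smul (m : ℕ) (c : ℝ) (g : H) :
    kernelPower e m (c • g) = c ^ (2 * (m + 1)) * kernelPower e m g := by
  simp only [kernelPower, real_inner_smul_left, mul_pow, ← integral_const_mul, mul_assoc]

theorem kernelPower_pos (he : IsRadialKernel e) {m : ℕ} (hm : 2 < m) {g : H} {r : ℝ}
    (hr : 1 < r) (hgr : inner ℝ g (e r) ≠ 0) : 0 < kernelPower e m g := by
  have hnn : ∀ s ∈ Ioi (1 : ℝ), 0 ≤ inner ℝ g (e s) ^ (2 * (m + 1)) * s ^ 2 := fun s _ =>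
    mul_nonneg ((even_two_mul _).pow_nonneg _) (sq_nonneg s)
  refine (setIntegral_pos_iff_support_of_nonneg_ae
    (ae_restrict_of_forall_mem measurableSet_Ioi hnn)
    (integrableOn_inner_kernel_pow_even he hm g)).2 ?_
  have hopen : IsOpen (Ioi (1 : ℝ) ∩ (fun s => inner ℝ g (e s)) ⁻¹' {0}ᶜ) :=
    ((continuousOn_inner_kernel he g).mono Ioi_subset_Ici_self).isOpen_inter_preimage
      isOpen_Ioi isOpen_compl_singleton
  refine (hopen.measure_pos volume ⟨r, hr, hgr⟩).trans_le (measure_mono ?_)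
  rintro s ⟨hs, hs'⟩
  have hs0 : s ≠ 0 := (one_pos.trans hs).ne'
  exact ⟨mul_ne_zero (pow_ne_zero _ hs') (pow_ne_zero _ hs0), hs⟩

/-- The Euler–Lagrange equation of a constrained maximizer of `kernelPower`. -/
theorem exists_euler_lagrange [CompleteSpace H] (he : IsRadialKernel e) {m : ℕ} (hm : 2 < m)
    {g : H} (hg : ‖g‖ ≤ 1) (hg1 : inner ℝ g (e 1) = 0) (hpos : 0 < kernelPower e m g)
    (hmax : ∀ h : H, ‖h‖ ≤ 1 → inner ℝ h (e 1) = 0 → kernelPower e m h ≤ kernelPower e m g) :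
    ‖g‖ = 1 ∧ ∃ c l : ℝ, ∀ h : H, inner ℝ h g =
      c * ((∫ r in Ioi 1, inner ℝ g (e r) ^ (2 * m + 1) * r ^ 2 * inner ℝ h (e r))
        - l * inner ℝ h (e 1)) := by
  set F : ℝ → ℝ := fun r => inner ℝ g (e r) ^ (2 * m + 1) * r ^ 2 with hF
  set ψ : H := ∫ r in Ioi 1, F r • e r with hψ
  have hFint : IntegrableOn (fun r => F r • e r) (Ioi 1) :=
    integrableOn_inner_kernel_pow_smul he hm g
  have hinner : ∀ h : H, inner ℝ h ψ = ∫ r in Ioi 1, F r * inner ℝ h (e r) := fun h => by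
    rw [hψ, ← integral_inner hFint h]
    simp only [real_inner_smul_right]
  have hFi : ∀ h : H, IntegrableOn (fun r => F r * inner ℝ h (e r)) (Ioi 1) := fun h => by
    have := Integrable.const_inner (𝕜 := ℝ) h hFint
    simp only [real_inner_smul_right] at this
    exact this
  have he1 : (inner ℝ (e 1) (e 1) : ℝ) = 1 := by rw [he 1 1 le_rfl le_rfl]; simp
  set w : H := ψ - inner ℝ ψ (e 1) • e 1 with hw
  have hw1 : inner ℝ w (e 1) = 0 := by
    rw [hw, inner_sub_left, real_inner_smul_left, he1, mul_one, sub_self]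
  have hinner_w : ∀ h : H, inner ℝ h (e 1) = 0 → inner ℝ h w = inner ℝ h ψ := fun h hh => by
    rw [hw, inner_sub_right, real_inner_smul_right, hh, mul_zero, sub_zero]
  have hgψ : inner ℝ g ψ = kernelPower e m g := by
    rw [hinner, kernelPower]
    congr 1
    ext r
    rw [hF]
    ring
  have hw0 : 0 < ‖w‖ := by
    refine norm_pos_iff.2 fun h0 => hpos.ne' ?_
    rw [← hgψ, ← hinner_w g hg1, h0, inner_zero_right]
  set h : H := ‖w‖⁻¹ • w with hh
  have hnorm : ‖h‖ = 1 := by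
    rw [hh, norm_smul, norm_inv, norm_norm, inv_mul_cancel₀ hw0.ne']
  have hh1 : inner ℝ h (e 1) = 0 := by rw [hh, real_inner_smul_left, hw1, mul_zero]
  have hhψ : inner ℝ h ψ = ‖w‖ := by
    rw [← hinner_w h hh1, hh, real_inner_smul_left, real_inner_self_eq_norm_sq]
    field_simp
  have hconv : kernelPower e m g + (2 * (m + 1)) * (inner ℝ h ψ - inner ℝ g ψ) ≤
      kernelPower e m h := by
    have hdiff : IntegrableOn (fun r => (2 * (m + 1) : ℝ) *
        (F r * inner ℝ h (e r) - F r * inner ℝ g (e r))) (Ioi 1) :=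
      ((hFi h).sub (hFi g)).const_mul _
    rw [hinner, hinner, ← integral_sub (hFi h) (hFi g), ← integral_const_mul, kernelPower,
      ← integral_add (integrableOn_inner_kernel_pow_even he hm g) hdiff]
    refine setIntegral_mono_on ((integrableOn_inner_kernel_pow_even he hm g).add hdiff)
      (integrableOn_inner_kernel_pow_even he hm h) measurableSet_Ioi fun r _ => ?_
    have := mul_le_mul_of_nonneg_right
      (add_mul_sub_le_pow_of_even m (inner ℝ h (e r)) (inner ℝ g (e r))) (sq_nonneg r)
    refine le_trans (le_of_eq ?_) this
    simp only [hF]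
    ring
  have hle : ‖w‖ ≤ inner ℝ g w := by
    rw [hinner_w g hg1, ← hhψ]
    have h1 := hmax h hnorm.le hh1
    have h2 : (0 : ℝ) < 2 * (m + 1) := by positivity
    nlinarith
  have hCS : inner ℝ g w ≤ ‖g‖ * ‖w‖ := real_inner_le_norm g w
  have hg_norm : ‖g‖ = 1 := le_antisymm hg (by nlinarith)
  have hgh : g = h := by
    refine (inner_eq_one_iff_of_norm_eq_one (𝕜 := ℝ) hg_norm hnorm).1 ?_
    rw [hh, real_inner_smul_right]
    rw [hg_norm, one_mul] at hCS
    rw [le_antisymm hCS hle, inv_mul_cancel₀ hw0.ne']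
  refine ⟨hg_norm, ‖w‖⁻¹, inner ℝ ψ (e 1), fun k => ?_⟩
  rw [← hinner]
  conv_lhs => rw [hgh, hh, real_inner_smul_right, hw, inner_sub_right, real_inner_smul_right]

/-- A solution of the Euler–Lagrange equation has a continuously differentiable profile `f`, and
`r ^ 2 * f' r` is bounded with derivative `-c * f r ^ (2 * m + 1) * r ^ 2`. -/
theorem exists_hasDerivAt_of_euler_lagrange (he : IsRadialKernel e) {m : ℕ} (hm : 2 < m) {g : H}
    {c l : ℝ} (hEL : ∀ h : H, inner ℝ h g =
      c * ((∫ r in Ioi 1, inner ℝ g (e r) ^ (2 * m + 1) * r ^ 2 * inner ℝ h (e r))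
        - l * inner ℝ h (e 1))) :
    ∃ v : ℝ → ℝ, (∃ C, ∀ r, 1 < r → |v r| ≤ C) ∧
      (∀ r, 1 < r → HasDerivAt (fun s => inner ℝ g (e s)) (v r / r ^ 2) r) ∧
      ∀ r, 1 < r → HasDerivAt v (-c * (inner ℝ g (e r) ^ (2 * m + 1) * r ^ 2)) r := by
  set F : ℝ → ℝ := fun r => inner ℝ g (e r) ^ (2 * m + 1) * r ^ 2 with hF
  have hFcont : ContinuousOn F (Ioi 1) :=
    (((continuousOn_inner_kernel he g).pow _).mul (continuousOn_id.pow 2)).mono Ioi_subset_Ici_self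
  have hFint : IntegrableOn F (Ioi 1) := integrableOn_inner_kernel_pow he hm g
  have hGcont : ContinuousOn (fun s => F s * s⁻¹) (Ioi 1) :=
    hFcont.mul (continuousOn_id.inv₀ fun s hs => (one_pos.trans hs).ne')
  have hGint : IntegrableOn (fun s => F s * s⁻¹) (Ioi 1) := by
    refine hFint.norm.mono' (hGcont.aestronglyMeasurable measurableSet_Ioi) ?_
    refine ae_restrict_of_forall_mem measurableSet_Ioi fun s hs => ?_
    rw [norm_mul]
    refine mul_le_of_le_one_right (norm_nonneg _) ?_
    rw [norm_inv, norm_eq_abs, abs_of_pos (one_pos.trans hs)]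
    exact inv_le_one_of_one_le₀ (le_of_lt hs)
  have hderiv : ∀ {G : ℝ → ℝ}, ContinuousOn G (Ioi 1) → IntegrableOn G (Ioi 1) →
      ∀ r, 1 < r → HasDerivAt (fun u => ∫ s in (1 : ℝ)..u, G s) (G r) r := by
    intro G hc hi r hr
    refine intervalIntegral.integral_hasDerivAt_right ?_
      (hc.stronglyMeasurableAtFilter isOpen_Ioi r hr) (hc.continuousAt (Ioi_mem_nhds hr))
    exact (intervalIntegrable_iff_integrableOn_Ioc_of_le hr.le).2
      (hi.mono_set Ioc_subset_Ioi_self)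
  have hrep : ∀ r, 1 < r → inner ℝ g (e r) = c * (r⁻¹ * (∫ s in (1 : ℝ)..r, F s)
      + ((∫ s in Ioi 1, F s * s⁻¹) - ∫ s in (1 : ℝ)..r, F s * s⁻¹) - l * r⁻¹) := by
    intro r hr
    have hsplit : Ioi (1 : ℝ) = Ioc 1 r ∪ Ioi r := (Ioc_union_Ioi_eq_Ioi hr.le).symm
    have hdisj : Disjoint (Ioc (1 : ℝ) r) (Ioi r) := Ioc_disjoint_Ioi le_rfl
    have h1 : EqOn (fun s => F s * inner ℝ (e r) (e s)) (fun s => r⁻¹ * F s) (Ioc 1 r) := by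
      intro s hs
      simp only [he r s hr.le hs.1.le, max_eq_left hs.2, mul_comm]
    have h2 : EqOn (fun s => F s * inner ℝ (e r) (e s)) (fun s => F s * s⁻¹) (Ioi r) := by
      intro s hs
      simp only [he r s hr.le (hr.trans hs).le, max_eq_right (mem_Ioi.1 hs).le]
    have hi1 : IntegrableOn F (Ioc 1 r) := hFint.mono_set Ioc_subset_Ioi_self
    have hi2 : IntegrableOn (fun s => F s * s⁻¹) (Ioi r) :=
      hGint.mono_set (Ioi_subset_Ioi hr.le)
    have hi3 : IntegrableOn (fun s => F s * s⁻¹) (Ioc 1 r) :=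
      hGint.mono_set Ioc_subset_Ioi_self
    rw [real_inner_comm, hEL, he r 1 hr.le le_rfl, max_eq_left hr.le,
      intervalIntegral.integral_of_le hr.le, intervalIntegral.integral_of_le hr.le, hsplit,
      setIntegral_union hdisj measurableSet_Ioi hi3 hi2,
      setIntegral_union hdisj measurableSet_Ioi
        (IntegrableOn.congr_fun (hi1.const_mul _) h1.symm measurableSet_Ioc)
        (hi2.congr_fun h2.symm measurableSet_Ioi),
      setIntegral_congr_fun measurableSet_Ioc h1, setIntegral_congr_fun measurableSet_Ioi h2,
      integral_const_mul, add_sub_cancel_left]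
  refine ⟨fun r => c * (l - ∫ s in (1 : ℝ)..r, F s), ⟨|c| * (|l| + ∫ s in Ioi 1, ‖F s‖), ?_⟩,
    ?_, ?_⟩
  · intro r hr
    rw [abs_mul]
    gcongr
    refine (abs_sub _ _).trans ?_
    gcongr
    rw [intervalIntegral.integral_of_le hr.le]
    rw [← norm_eq_abs]
    refine (norm_integral_le_integral_norm _).trans ?_
    exact setIntegral_mono_set hFint.norm (ae_of_all _ fun s => norm_nonneg _)
      Ioc_subset_Ioi_self.eventuallyLE
  · intro r hr
    have hr0 : r ≠ 0 := (one_pos.trans hr).ne'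
    have hinv := hasDerivAt_inv hr0
    have key := ((((hinv.mul (hderiv hFcont hFint r hr)).add
      ((hasDerivAt_const r (∫ s in Ioi 1, F s * s⁻¹)).sub (hderiv hGcont hGint r hr))).sub
        (hinv.const_mul l)).const_mul c)
    refine (key.congr_of_eventuallyEq ?_).congr_deriv ?_
    · filter_upwards [Ioi_mem_nhds hr] with s hs using hrep s hs
    · field_simp
      ring
  · intro r hr
    exact (((hderiv hFcont hFint r hr).const_sub l).const_mul c).congr_deriv (by ring)

theorem tendsto_inner_kernel_atTop (he : IsRadialKernel e) (g : H) :
    Tendsto (fun r => inner ℝ g (e r)) atTop (𝓝 0) := by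
  refine squeeze_zero_norm' (a := fun r : ℝ => ‖g‖ * r ^ (-(1 / 2) : ℝ)) ?_ ?_
  · filter_upwards [eventually_ge_atTop 1] with r hr using abs_inner_kernel_le he g hr
  · simpa using (tendsto_rpow_neg_atTop (y := 1 / 2) (by norm_num)).const_mul ‖g‖

theorem integral_deriv_sq_of_euler_lagrange (he : IsRadialKernel e) {m : ℕ} (hm : 2 < m) {g : H}
    (hg1 : inner ℝ g (e 1) = 0) {c l : ℝ} (hEL : ∀ h : H, inner ℝ h g =
      c * ((∫ r in Ioi 1, inner ℝ g (e r) ^ (2 * m + 1) * r ^ 2 * inner ℝ h (e r))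
        - l * inner ℝ h (e 1))) :
    (∀ r, 1 < r → DifferentiableAt ℝ (fun s => inner ℝ g (e s)) r) ∧
    IntegrableOn (fun r => deriv (fun s => inner ℝ g (e s)) r ^ 2 * r ^ 2) (Ioi 1) ∧
    ∫ r in Ioi 1, deriv (fun s => inner ℝ g (e s)) r ^ 2 * r ^ 2 = ‖g‖ ^ 2 := by
  obtain ⟨v, ⟨C, hC⟩, hf, hv⟩ := exists_hasDerivAt_of_euler_lagrange he hm hEL
  have hC0 : 0 ≤ C := (abs_nonneg _).trans (hC 2 one_lt_two)
  have heq : EqOn (fun r => v r / r ^ 2 * v r)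
      (fun r => deriv (fun s => inner ℝ g (e s)) r ^ 2 * r ^ 2) (Ioi 1) := by
    intro r hr
    have hr0 : r ≠ 0 := (one_pos.trans hr).ne'
    simp only [(hf r hr).deriv]
    field_simp
  have hvcont : ContinuousOn v (Ioi 1) := fun r hr => (hv r hr).continuousAt.continuousWithinAt
  have hint : IntegrableOn (fun r => v r / r ^ 2 * v r) (Ioi 1) := by
    refine ((integrableOn_Ioi_rpow_of_lt (a := -2) (by norm_num) one_pos).const_mul
      (C ^ 2)).mono' ?_ ?_
    · exact ((hvcont.div (continuousOn_id.pow 2)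
        fun r hr => pow_ne_zero 2 (one_pos.trans hr).ne').mul hvcont).aestronglyMeasurable
        measurableSet_Ioi
    · refine ae_restrict_of_forall_mem measurableSet_Ioi fun r hr => ?_
      have hr0 : (0 : ℝ) < r := one_pos.trans hr
      have : v r / r ^ 2 * v r = |v r| ^ 2 * r ^ (-2 : ℝ) := by
        rw [sq_abs, rpow_neg hr0.le, rpow_two]
        field_simp
      rw [this, norm_of_nonneg (by positivity)]
      gcongr
      exact hC r hr
  have hzero : Tendsto (fun r => inner ℝ g (e r) * v r) (𝓝[>] 1) (𝓝 0) := by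
    refine squeeze_zero_norm' (a := fun r => |inner ℝ g (e r)| * C) ?_ ?_
    · filter_upwards [self_mem_nhdsWithin] with r hr
      rw [norm_mul]
      exact mul_le_mul_of_nonneg_left (hC r hr) (norm_nonneg _)
    · have := ((continuousOn_inner_kernel he g 1 self_mem_Ici).mono
        Ioi_subset_Ici_self).tendsto.abs.mul_const C
      simpa [hg1] using this
  have htop : Tendsto (fun r => inner ℝ g (e r) * v r) atTop (𝓝 0) := by
    refine squeeze_zero_norm' (a := fun r => |inner ℝ g (e r)| * C) ?_ ?_
    · filter_upwards [eventually_gt_atTop 1] with r hr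
      rw [norm_mul]
      exact mul_le_mul_of_nonneg_left (hC r hr) (norm_nonneg _)
    · simpa using (tendsto_inner_kernel_atTop he g).abs.mul_const C
  have hint' : IntegrableOn (fun r => inner ℝ g (e r) *
      (-c * (inner ℝ g (e r) ^ (2 * m + 1) * r ^ 2))) (Ioi 1) := by
    refine IntegrableOn.congr_fun ((integrableOn_inner_kernel_pow_even he hm g).const_mul (-c))
      (fun r _ => ?_) measurableSet_Ioi
    ring
  have hparts := integral_Ioi_mul_deriv_eq_deriv_mul hf hv hint' hint hzero htop
  refine ⟨fun r hr => (hf r hr).differentiableAt, hint.congr_fun heq measurableSet_Ioi, ?_⟩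
  have hnorm := hEL g
  rw [real_inner_self_eq_norm_sq, hg1, mul_zero, sub_zero] at hnorm
  rw [← setIntegral_congr_fun measurableSet_Ioi heq, hnorm, ← integral_const_mul]
  rw [sub_zero, zero_sub, eq_neg_iff_add_eq_zero, add_comm, ← eq_neg_iff_add_eq_zero,
    ← integral_neg] at hparts
  rw [hparts]
  congr 1
  ext r
  ring

end Kernel

theorem memLp_indicator_inv (r : ℝ) :
    MemLp ((Ioi r).indicator fun s : ℝ => s⁻¹) 2 (volume.restrict (Ioi 1)) := by
  refine MemLp.indicator measurableSet_Ioi ?_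
  refine (memLp_two_iff_integrable_sq measurable_inv.aestronglyMeasurable).2 ?_
  refine IntegrableOn.congr_fun
    (integrableOn_Ioi_rpow_of_lt (a := -2) (by norm_num) one_pos) (fun s hs => ?_)
    measurableSet_Ioi
  have hs0 : (0 : ℝ) < s := one_pos.trans hs
  simp only [rpow_neg hs0.le, rpow_two, inv_pow]

/-- The function `s ↦ 1 / s` on `s > r`, as an element of `L²(1, ∞)`. -/
noncomputable def radialKernel (r : ℝ) : Lp ℝ 2 (volume.restrict (Ioi (1 : ℝ))) :=
  (memLp_indicator_inv r).toLp _

theorem inner_radialKernel (g : Lp ℝ 2 (volume.restrict (Ioi (1 : ℝ)))) {r : ℝ} (hr : 1 ≤ r) :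
    inner ℝ g (radialKernel r) = ∫ s in Ioi r, g s * s⁻¹ := by
  rw [L2.inner_def]
  have h1 : (fun s => inner ℝ (g s) (radialKernel r s)) =ᵐ[volume.restrict (Ioi (1 : ℝ))]
      (Ioi r).indicator fun s => g s * s⁻¹ := by
    filter_upwards [(memLp_indicator_inv r).coeFn_toLp] with s hs
    rw [radialKernel, hs]
    by_cases h : s ∈ Ioi r <;> simp [h, mul_comm]
  rw [integral_congr_ae h1, setIntegral_indicator measurableSet_Ioi,
    inter_eq_right.2 (Ioi_subset_Ioi hr)]

theorem isRadialKernel_radialKernel : IsRadialKernel radialKernel := by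
  intro r s hr hs
  have h0 : (0 : ℝ) < max r s := one_pos.trans_le (hr.trans (le_max_left _ _))
  rw [inner_radialKernel _ hs]
  have h1 : (fun t => radialKernel r t * t⁻¹) =ᵐ[volume.restrict (Ioi s)]
      (Ioi r).indicator fun t => t ^ (-2 : ℝ) := by
    filter_upwards [ae_restrict_of_ae_restrict_of_subset (Ioi_subset_Ioi hs)
      (memLp_indicator_inv r).coeFn_toLp, ae_restrict_mem measurableSet_Ioi] with t ht hts
    have ht0 : 0 < t := one_pos.trans (hs.trans_lt hts)
    rw [radialKernel, ht]
    by_cases h : t ∈ Ioi r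
    · simp only [indicator_of_mem h, rpow_neg ht0.le, rpow_two]
      field_simp
    · simp [h]
  rw [integral_congr_ae h1, setIntegral_indicator measurableSet_Ioi, Ioi_inter_Ioi, sup_comm,
    integral_Ioi_rpow_of_lt (by norm_num) h0]
  norm_num [rpow_neg_one]

theorem AdmissibleRadial.exists_inner_radialKernel {m : ℕ} {f : ℝ → ℝ}
    (hf : AdmissibleRadial m f) :
    ∃ g : Lp ℝ 2 (volume.restrict (Ioi (1 : ℝ))),
      ‖g‖ ^ 2 = ∫ r in Ioi 1, deriv f r ^ 2 * r ^ 2 ∧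
      ∀ r, 1 ≤ r → inner ℝ g (radialKernel r) = -f r := by
  obtain ⟨hcont, -, hdiff, htop, hint, -, -⟩ := hf
  have hmem : MemLp (fun r => deriv f r * r) 2 (volume.restrict (Ioi (1 : ℝ))) := by
    have hmeas : Measurable fun r => deriv f r * r := (measurable_deriv f).mul measurable_id
    refine (memLp_two_iff_integrable_sq hmeas.aestronglyMeasurable).2 ?_
    simp only [mul_pow]
    exact hint
  refine ⟨hmem.toLp _, ?_, fun r hr => ?_⟩
  · rw [← real_inner_self_eq_norm_sq, L2.inner_def]
    refine integral_congr_ae ?_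
    filter_upwards [hmem.coeFn_toLp] with r hr
    rw [hr, real_inner_self_eq_norm_sq, norm_eq_abs, sq_abs, mul_pow]
  · have hae : (fun s => hmem.toLp _ s * s⁻¹) =ᵐ[volume.restrict (Ioi r)] deriv f := by
      filter_upwards [ae_restrict_of_ae_restrict_of_subset (Ioi_subset_Ioi hr) hmem.coeFn_toLp,
        ae_restrict_mem measurableSet_Ioi] with s hs hsr
      have hs0 : s ≠ 0 := (one_pos.trans (hr.trans_lt hsr)).ne'
      rw [hs]
      field_simp
    have hinv : MemLp (fun s : ℝ => s⁻¹) 2 (volume.restrict (Ioi (1 : ℝ))) := by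
      refine (memLp_indicator_inv 1).ae_eq ?_
      filter_upwards [ae_restrict_mem measurableSet_Ioi] with s hs
      rw [indicator_of_mem hs]
    have hint1 : IntegrableOn (deriv f) (Ioi r) := by
      have : IntegrableOn (fun s => hmem.toLp _ s * s⁻¹) (Ioi 1) :=
        (Lp.memLp (hmem.toLp _)).integrable_mul hinv
      exact Integrable.congr (this.mono_set (Ioi_subset_Ioi hr)) hae
    rw [inner_radialKernel _ hr, integral_congr_ae hae,
      integral_Ioi_of_hasDerivAt_of_tendsto
        ((hcont r hr).mono (Ici_subset_Ici.2 hr)) (fun s hs => ?_) hint1 htop, zero_sub]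
    exact ((hdiff s (hr.trans_lt hs)).differentiableAt
      (Ioi_mem_nhds (hr.trans_lt hs))).hasDerivAt

theorem exists_ne_zero_inner_radialKernel :
    ∃ g : Lp ℝ 2 (volume.restrict (Ioi (1 : ℝ))), inner ℝ g (radialKernel 1) = 0 ∧
      inner ℝ g (radialKernel 2) ≠ 0 := by
  have he := isRadialKernel_radialKernel
  refine ⟨radialKernel 1 - (2 : ℝ) • radialKernel 2, ?_, ?_⟩ <;>
  · rw [inner_sub_left, real_inner_smul_left, he _ _ (by norm_num) (by norm_num),
      he _ _ (by norm_num) (by norm_num)]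
    norm_num

/-- The infimum of the Sobolev quotient over nonzero radial functions of
`Ḣ¹₀(Ω)` is positive and attained at some radial `φ⋆` with
`‖∇φ⋆‖_{L²(Ω)} = 1`. -/
theorem sobolev_quotient_minimizer_exists (m : ℕ) (hm : 2 < m) :
    0 < sInf (SobolevQuotient m '' {f | AdmissibleRadial m f}) ∧
    ∃ φ : ℝ → ℝ, AdmissibleRadial m φ ∧
      4 * π * (∫ r in Ioi 1, (deriv φ r)^2 * r^2) = 1 ∧
      SobolevQuotient m φ =
        sInf (SobolevQuotient m '' {f | AdmissibleRadial m f}) := by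
  have : Fact ((2 : ENNReal) ≠ ⊤) := ⟨by norm_num⟩
  have he := isRadialKernel_radialKernel
  have hpow : ∀ x : ℝ, |x| ^ (2 * (m + 1)) = x ^ (2 * (m + 1)) := (even_two_mul _).pow_abs
  obtain ⟨g, hg, hg1, hmax⟩ := exists_kernelPower_maximizer he hm
  have hbound : ∀ h, inner ℝ h (radialKernel 1) = 0 →
      kernelPower radialKernel m h ≤ kernelPower radialKernel m g * (‖h‖ ^ 2) ^ (m + 1) := by
    intro h hh
    rcases eq_or_ne h 0 with rfl | h0
    · simp [kernelPower]
    have hn : 0 < ‖h‖ := norm_pos_iff.2 h0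
    have := hmax (‖h‖⁻¹ • h) (by rw [norm_smul, norm_inv, norm_norm, inv_mul_cancel₀ hn.ne'])
      (by rw [real_inner_smul_left, hh, mul_zero])
    rwa [kernelPower_smul, inv_pow, inv_mul_le_iff₀ (by positivity), pow_mul, mul_comm] at this
  have hpos : 0 < kernelPower radialKernel m g := by
    obtain ⟨h, hh1, hh2⟩ := exists_ne_zero_inner_radialKernel
    have h1 := (kernelPower_pos he hm one_lt_two hh2).trans_le (hbound h hh1)
    exact pos_of_mul_pos_left h1 (by positivity)
  obtain ⟨hnorm, c, l, hEL⟩ := exists_euler_lagrange he hm hg hg1 hpos hmax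
  obtain ⟨hdiff, hint, hderiv⟩ := integral_deriv_sq_of_euler_lagrange he hm hg1 hEL
  have hπ : 0 < 4 * π := by positivity
  set k : ℝ := (√(4 * π))⁻¹ with hk
  have hk0 : k ≠ 0 := by positivity
  have hk2 : k ^ 2 = (4 * π)⁻¹ := by rw [hk, inv_pow, sq_sqrt hπ.le]
  set φ : ℝ → ℝ := fun r => k * inner ℝ g (radialKernel r) with hφ
  have hφd : EqOn (fun r => k ^ 2 * (deriv (fun s => inner ℝ g (radialKernel s)) r ^ 2 * r ^ 2))
      (fun r => deriv φ r ^ 2 * r ^ 2) (Ioi 1) := by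
    intro r hr
    simp only [hφ, deriv_const_mul k (hdiff r hr)]
    ring
  have hφN : (fun r => |φ r| ^ (2 * (m + 1)) * r ^ 2) =
      fun r => k ^ (2 * (m + 1)) * (inner ℝ g (radialKernel r) ^ (2 * (m + 1)) * r ^ 2) := by
    ext r
    rw [hpow, hφ, mul_pow, mul_assoc]
  have hφD : 4 * π * (∫ r in Ioi 1, (deriv φ r)^2 * r^2) = 1 := by
    rw [← setIntegral_congr_fun measurableSet_Ioi hφd, integral_const_mul, hderiv, hnorm, hk2]
    field_simp
  have hadm : AdmissibleRadial m φ := by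
    refine ⟨continuousOn_const.mul (continuousOn_inner_kernel he g), by simp [hφ, hg1],
      fun r hr => ((hdiff r hr).const_mul k).differentiableWithinAt, ?_,
      IntegrableOn.congr_fun (hint.const_mul _) hφd measurableSet_Ioi, ?_, ?_⟩
    · simpa using (tendsto_inner_kernel_atTop he g).const_mul k
    · rw [hφN]
      exact (integrableOn_inner_kernel_pow_even he hm g).const_mul _
    · by_contra! hzero
      refine hpos.ne' (setIntegral_eq_zero_of_forall_eq_zero fun r hr => ?_)
      have := (mul_eq_zero.1 (hzero r hr)).resolve_left hk0
      rw [this, zero_pow (by omega), zero_mul]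
  have hJφ : SobolevQuotient m φ =
      (4 * π) ^ (m + 1) / (4 * π * kernelPower radialKernel m g) := by
    rw [SobolevQuotient, hφD, hφN, integral_const_mul, pow_mul, hk2, one_pow, ← kernelPower, inv_pow]
    field_simp
  have hleast : IsLeast (SobolevQuotient m '' {f | AdmissibleRadial m f})
      (SobolevQuotient m φ) := by
    refine ⟨⟨φ, hadm, rfl⟩, ?_⟩
    rintro _ ⟨f, hf, rfl⟩
    obtain ⟨h, hhn, hhf⟩ := hf.exists_inner_radialKernel
    have hN : (∫ r in Ioi 1, |f r| ^ (2 * (m + 1)) * r ^ 2) = kernelPower radialKernel m h := by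
      refine setIntegral_congr_fun measurableSet_Ioi fun r hr => ?_
      simp only [hhf r (le_of_lt hr), (even_two_mul (m + 1)).neg_pow, hpow]
    have hh1 : inner ℝ h (radialKernel 1) = 0 := by rw [hhf 1 le_rfl, hf.2.1, neg_zero]
    have hNpos : 0 < kernelPower radialKernel m h := by
      obtain ⟨r, hr, hfr⟩ := hf.2.2.2.2.2.2
      refine kernelPower_pos he hm hr ?_
      rw [hhf r hr.le]
      exact neg_ne_zero.2 hfr
    rw [hJφ, SobolevQuotient, hN, ← hhn, div_le_div_iff₀ (by positivity) (by positivity),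
      mul_pow (4 * π)]
    have := mul_le_mul_of_nonneg_left (hbound h hh1)
      (show 0 ≤ (4 * π) ^ (m + 1) * (4 * π) by positivity)
    linarith
  rw [hleast.csInf_eq]
  refine ⟨?_, φ, hadm, hφD, rfl⟩
  rw [hJφ]
  positivity
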